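/- arXiv:1102.5434 — 8 statements merged into one kernel-verified Lean document; each statement's English description precedes it below -/
import Mathlib

section
/- Let k ≥ 1. An element f ∈ M satisfies Dᵏ f = 0 if and only if there exist f₀, f₁, …, f_{k−1} ∈ ker D such that f = Σ_{s=0}^{k−1} xˢ f_s; moreover, the elements f₀, …, f_{k−1} ∈ ker D in such a representation are uniquely determined by f. Equivalently, ker(Dᵏ) is the internal direct sum ker D ⊕ x(ker D) ⊕ x²(ker D) ⊕ ⋯ ⊕ x^{k−1}(ker D). (Almansi-type decomposition for umbral polymonogenic functions of degree k.) -/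
/-- The operator `U_s`: `U_{2k} = k·id` and `U_{2k+1} = E + (n/2 + k)·id`. -/
noncomputable def Uop {M : Type*} [AddCommGroup M] [Module ℝ M]
    (n : ℕ) (E : Module.End ℝ M) (s : ℕ) : Module.End ℝ M :=
  if s % 2 = 0 then ((s / 2 : ℕ) : ℝ) • (1 : Module.End ℝ M)
  else E + (((n : ℝ) / 2) + ((s / 2 : ℕ) : ℝ)) • (1 : Module.End ℝ M)

/-- The inverse `(U_s)⁻¹`: `(U_{2j})⁻¹ = (1/j)·id` and `(U_{2j+1})⁻¹ = I_j`. -/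
noncomputable def UopInv {M : Type*} [AddCommGroup M] [Module ℝ M]
    (I : ℕ → Module.End ℝ M) (s : ℕ) : Module.End ℝ M :=
  if s % 2 = 0 then ((1 : ℝ) / ((s / 2 : ℕ) : ℝ)) • (1 : Module.End ℝ M)
  else I (s / 2)

/-- The operator `Q_k = (−1/2)ᵏ (U_k)⁻¹∘(U_{k−1})⁻¹∘⋯∘(U_1)⁻¹`. -/
noncomputable def Qop {M : Type*} [AddCommGroup M] [Module ℝ M]
    (I : ℕ → Module.End ℝ M) : ℕ → Module.End ℝ M
  | 0 => 1
  | k + 1 => ((-1 : ℝ) / 2) • (UopInv I (k + 1) * Qop I k)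

/-- If `D x^(s+1) = x^s V_s` on `ker D`, with each `V_s` invertible on `ker D`, then every
element of `ker D^k` is a sum of terms `x^s g_s` with `s < k` and `g_s ∈ ker D`. -/
theorem pow_apply_eq_zero_iff_exists_sum {R M : Type*} [Ring R] [AddCommGroup M] [Module R M]
    {x D : Module.End R M} {V W : ℕ → Module.End R M}
    (hDx : ∀ s m, D m = 0 → D ((x ^ (s + 1)) m) = (x ^ s) (V s m))
    (hV : ∀ s m, D m = 0 → D (V s m) = 0) (hW : ∀ s m, D m = 0 → D (W s m) = 0)
    (hVW : ∀ s m, V s (W s m) = m) (k : ℕ) (f : M) :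
    (D ^ k) f = 0 ↔
      ∃ g : Fin k → M, (∀ s, D (g s) = 0) ∧ f = ∑ s : Fin k, (x ^ (s : ℕ)) (g s) := by
  induction k generalizing f with
  | zero => simp
  | succ k ih =>
    rw [pow_succ, Module.End.mul_apply, ih]
    constructor
    · rintro ⟨g, hg, hf⟩
      refine ⟨Fin.cons (f - ∑ s : Fin k, (x ^ (s + 1 : ℕ)) (W s (g s))) fun s => W s (g s),
        ?_, ?_⟩
      · intro s
        refine Fin.cases ?_ (fun s => ?_) s
        · simp only [Fin.cons_zero, map_sub, map_sum, hf]
          rw [sub_eq_zero]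
          refine Finset.sum_congr rfl fun s _ => ?_
          rw [hDx _ _ (hW _ _ (hg s)), hVW]
        · simpa using hW _ _ (hg s)
      · simp [Fin.sum_univ_succ]
    · rintro ⟨g, hg, rfl⟩
      refine ⟨fun s => V s (g s.succ), fun s => hV _ _ (hg _), ?_⟩
      simp [Fin.sum_univ_succ, hg, hDx]

/-- If `D x^(s+1) = x^s V_s` on `ker D`, with each `V_s` injective and preserving `ker D`, then
a vanishing sum of terms `x^s g_s` with `g_s ∈ ker D` has all `g_s = 0`. -/
theorem eq_zero_of_sum_pow_apply_eq_zero {R M : Type*} [Ring R] [AddCommGroup M] [Module R M]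
    {x D : Module.End R M} {V : ℕ → Module.End R M}
    (hDx : ∀ s m, D m = 0 → D ((x ^ (s + 1)) m) = (x ^ s) (V s m))
    (hV : ∀ s m, D m = 0 → D (V s m) = 0) (hVinj : ∀ s m, V s m = 0 → m = 0)
    (k : ℕ) (g : Fin k → M) (hg : ∀ s, D (g s) = 0)
    (hsum : ∑ s : Fin k, (x ^ (s : ℕ)) (g s) = 0) (s : Fin k) : g s = 0 := by
  induction k with
  | zero => exact s.elim0
  | succ k ih =>
    have hsucc : ∀ s : Fin k, g s.succ = 0 := fun s => by
      refine hVinj s _ (ih (fun s => V s (g s.succ)) (fun s => hV _ _ (hg _)) ?_ s)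
      have h := congrArg D hsum
      simpa [Fin.sum_univ_succ, hg, hDx] using h
    refine Fin.cases ?_ hsucc s
    simpa [Fin.sum_univ_succ, hsucc] using hsum

section Umbral

variable {M : Type*} [AddCommGroup M] [Module ℝ M] {n : ℕ} {x D E : Module.End ℝ M}

theorem euler_apply_pow_apply (hEx : E * x - x * E = x) (s : ℕ) (m : M) :
    E ((x ^ s) m) = (x ^ s) (E m) + (s : ℝ) • (x ^ s) m := by
  have hEx' : ∀ m, E (x m) = x (E m) + x m := fun m => by
    have h := LinearMap.congr_fun hEx m
    simp only [LinearMap.sub_apply, Module.End.mul_apply] at h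
    rw [sub_eq_iff_eq_add] at h
    rw [h, add_comm]
  induction s with
  | zero => simp
  | succ s ih =>
    rw [pow_succ', Module.End.mul_apply, hEx', ih, Module.End.mul_apply, map_add, map_smul]
    push_cast
    module

theorem dirac_apply_euler_apply (hED : E * D - D * E = -D) (m : M) :
    D (E m) = E (D m) + D m := by
  have h := LinearMap.congr_fun hED m
  simp only [LinearMap.sub_apply, Module.End.mul_apply, LinearMap.neg_apply] at h
  rw [sub_eq_iff_eq_add] at h
  rw [h]
  abel

theorem dirac_apply_pow_succ_apply
    (hxD : x * D + D * x = (-2 : ℝ) • E - (n : ℝ) • (1 : Module.End ℝ M))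
    (hEx : E * x - x * E = x) (s : ℕ) {m : M} (hm : D m = 0) :
    D ((x ^ (s + 1)) m) = (x ^ s) ((-2 : ℝ) • Uop n E (s + 1) m) := by
  have hDx : ∀ m, D (x m) = (-2 : ℝ) • E m - (n : ℝ) • m - x (D m) := fun m => by
    have h := LinearMap.congr_fun hxD m
    simp only [LinearMap.sub_apply, LinearMap.add_apply, LinearMap.smul_apply,
      Module.End.mul_apply, Module.End.one_apply] at h
    rw [← h]
    abel
  induction s with
  | zero =>
    simp only [zero_add, pow_one, pow_zero, Module.End.one_apply, hDx, hm, map_zero, Uop]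
    simp only [Nat.one_mod, one_ne_zero, if_false, LinearMap.add_apply, LinearMap.smul_apply,
      Module.End.one_apply, Nat.reduceDiv, Nat.cast_zero]
    module
  | succ s ih =>
    rw [pow_succ', Module.End.mul_apply, hDx, ih, euler_apply_pow_apply hEx,
      ← Module.End.mul_apply x, ← pow_succ']
    rcases Nat.even_or_odd' s with ⟨j, rfl | rfl⟩
    · have h1 : (2 * j + 1) % 2 = 1 := by omega
      have h2 : (2 * j + 1) / 2 = j := by omega
      have h3 : (2 * j + 1 + 1) % 2 = 0 := by omega
      have h4 : (2 * j + 1 + 1) / 2 = j + 1 := by omega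
      simp only [Uop, h1, h2, h3, h4, one_ne_zero, if_false, if_true, LinearMap.add_apply,
        LinearMap.smul_apply, Module.End.one_apply, map_add, map_smul]
      push_cast
      module
    · have h1 : (2 * j + 1 + 1) % 2 = 0 := by omega
      have h2 : (2 * j + 1 + 1) / 2 = j + 1 := by omega
      have h3 : (2 * j + 1 + 1 + 1) % 2 = 1 := by omega
      have h4 : (2 * j + 1 + 1 + 1) / 2 = j + 1 := by omega
      simp only [Uop, h1, h2, h3, h4, one_ne_zero, if_false, if_true, LinearMap.add_apply,
        LinearMap.smul_apply, Module.End.one_apply, map_add, map_smul]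
      push_cast
      module

theorem dirac_apply_Uop_apply (hED : E * D - D * E = -D) (s : ℕ) {m : M} (hm : D m = 0) :
    D (Uop n E s m) = 0 := by
  unfold Uop
  split_ifs <;> simp [hm, dirac_apply_euler_apply hED]

variable {I : ℕ → Module.End ℝ M}

theorem Uop_mul_UopInv
    (hI : ∀ j : ℕ,
      (E + (((n : ℝ) / 2) + (j : ℝ)) • (1 : Module.End ℝ M)) * I j = 1 ∧
      I j * (E + (((n : ℝ) / 2) + (j : ℝ)) • (1 : Module.End ℝ M)) = 1)
    (s : ℕ) :
    Uop n E (s + 1) * UopInv I (s + 1) = 1 := by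
  unfold Uop UopInv
  split_ifs with h
  · have hs : (((s + 1) / 2 : ℕ) : ℝ) ≠ 0 := by
      rw [Nat.cast_ne_zero]
      omega
    rw [smul_mul_smul_comm, mul_one_div_cancel hs, one_mul, one_smul]
  · exact (hI _).1

theorem UopInv_mul_Uop
    (hI : ∀ j : ℕ,
      (E + (((n : ℝ) / 2) + (j : ℝ)) • (1 : Module.End ℝ M)) * I j = 1 ∧
      I j * (E + (((n : ℝ) / 2) + (j : ℝ)) • (1 : Module.End ℝ M)) = 1)
    (s : ℕ) :
    UopInv I (s + 1) * Uop n E (s + 1) = 1 := by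
  unfold Uop UopInv
  split_ifs with h
  · have hs : (((s + 1) / 2 : ℕ) : ℝ) ≠ 0 := by
      rw [Nat.cast_ne_zero]
      omega
    rw [smul_mul_smul_comm, one_div_mul_cancel hs, one_mul, one_smul]
  · exact (hI _).2

theorem dirac_apply_UopInv_apply
    (hI : ∀ j : ℕ,
      (E + (((n : ℝ) / 2) + (j : ℝ)) • (1 : Module.End ℝ M)) * I j = 1 ∧
      I j * (E + (((n : ℝ) / 2) + (j : ℝ)) • (1 : Module.End ℝ M)) = 1)
    (hED : E * D - D * E = -D) (s : ℕ) {m : M} (hm : D m = 0) :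
    D (UopInv I s m) = 0 := by
  unfold UopInv
  split_ifs
  · simp [hm]
  · generalize s / 2 = j
    have h := congrArg D (LinearMap.congr_fun (hI j).1 m)
    simp only [Module.End.mul_apply, LinearMap.add_apply, LinearMap.smul_apply,
      Module.End.one_apply, map_add, map_smul, dirac_apply_euler_apply hED, hm] at h
    have h' := LinearMap.congr_fun (hI (j + 1)).2 (D (I j m))
    simp only [Module.End.mul_apply, LinearMap.add_apply, LinearMap.smul_apply,
      Module.End.one_apply] at h'
    rw [← h', ← map_zero (I (j + 1)), ← h]
    congr 1
    push_cast
    module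

end Umbral

/-- Almansi-type decomposition. For `k ≥ 1`, `f ∈ ker(Dᵏ)` iff
`f = Σ_{s=0}^{k−1} xˢ f_s` with each `f_s ∈ ker D`, and the components `f_s` are
uniquely determined; i.e. `ker(Dᵏ) = ker D ⊕ x(ker D) ⊕ ⋯ ⊕ x^{k−1}(ker D)`. -/
theorem almansi_decomposition
    {M : Type*} [AddCommGroup M] [Module ℝ M] (n : ℕ) (hn : 0 < n)
    (x D E : Module.End ℝ M) (I : ℕ → Module.End ℝ M)
    (hxD : x * D + D * x = (-2 : ℝ) • E - (n : ℝ) • (1 : Module.End ℝ M))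
    (hEx : E * x - x * E = x)
    (hED : E * D - D * E = -D)
    (hI : ∀ j : ℕ,
      (E + (((n : ℝ) / 2) + (j : ℝ)) • (1 : Module.End ℝ M)) * I j = 1 ∧
      I j * (E + (((n : ℝ) / 2) + (j : ℝ)) • (1 : Module.End ℝ M)) = 1)
    (k : ℕ) (hk : 1 ≤ k) :
    (∀ f : M, (D ^ k) f = 0 ↔
      ∃ g : Fin k → M, (∀ s, D (g s) = 0) ∧
        f = ∑ s : Fin k, (x ^ (s : ℕ)) (g s)) ∧
    (∀ g g' : Fin k → M, (∀ s, D (g s) = 0) → (∀ s, D (g' s) = 0) →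
      ∑ s : Fin k, (x ^ (s : ℕ)) (g s) = ∑ s : Fin k, (x ^ (s : ℕ)) (g' s) →
      g = g') := by
  have hDx : ∀ s m, D m = 0 →
      D ((x ^ (s + 1)) m) = (x ^ s) (((-2 : ℝ) • Uop n E (s + 1)) m) :=
    fun s m hm => dirac_apply_pow_succ_apply hxD hEx s hm
  have hV : ∀ s m, D m = 0 → D (((-2 : ℝ) • Uop n E (s + 1)) m) = 0 := fun s m hm => by
    rw [LinearMap.smul_apply, map_smul, dirac_apply_Uop_apply hED _ hm, smul_zero]
  refine ⟨pow_apply_eq_zero_iff_exists_sum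
    (W := fun s => (-1 / 2 : ℝ) • UopInv I (s + 1)) hDx hV ?_ ?_ k, ?_⟩
  · intro s m hm
    rw [LinearMap.smul_apply, map_smul, dirac_apply_UopInv_apply hI hED _ hm, smul_zero]
  · intro s m
    rw [← Module.End.mul_apply, smul_mul_smul_comm, Uop_mul_UopInv hI]
    norm_num
  · intro g g' hg hg' h
    have hVinj : ∀ s m, ((-2 : ℝ) • Uop n E (s + 1)) m = 0 → m = 0 := fun s m hm => by
      have hU : Uop n E (s + 1) m = 0 := by simpa using hm
      rw [← Module.End.one_apply (R := ℝ) m, ← UopInv_mul_Uop hI s, Module.End.mul_apply, hU,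
        map_zero]
    funext s
    refine sub_eq_zero.mp (eq_zero_of_sum_pow_apply_eq_zero hDx hV hVinj k
      (fun s => g s - g' s) (fun s => by rw [map_sub, hg, hg', sub_zero]) ?_ s)
    simp only [map_sub, Finset.sum_sub_distrib, h, sub_self]
end

section
/- Let k ≥ 1 and for each s ∈ {0, 1, …, k−1} suppose given: an ℝ-linear endomorphism A_s of M and a real number a_s with A_s∘D − D∘A_s = a_s·D, such that A_s − j a_s·id is invertible for every j ∈ ℕ; and an ℝ-linear endomorphism R_s of M with Dˢ(R_s f) = 0 for every f ∈ ker D. Define the polynomial-type operator P_s = A_s∘xˢ + R_s. Then every f ∈ M with Dᵏ f = 0 admits a unique representation f = Σ_{s=0}^{k−1} P_s f_s with f₀, …, f_{k−1} ∈ ker D, and conversely every such sum lies in ker(Dᵏ); that is, ker(Dᵏ) = P₀(ker D) ⊕ P₁(ker D) ⊕ ⋯ ⊕ P_{k−1}(ker D). -/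
section Intertwining

variable {R M : Type*} [Ring R] [AddCommGroup M] [Module R M]

/-- If `D ∘ T = S ∘ D` with `T` and `S` invertible, then `T` permutes `ker D`. -/
theorem bijOn_ker_of_intertwine {D T S : Module.End R M} (h : D * T = S * D)
    (hT : IsUnit T) (hS : IsUnit S) :
    Set.BijOn T {f | D f = 0} {f | D f = 0} := by
  have h' (f : M) : D (T f) = S (D f) := LinearMap.congr_fun h f
  have bT := (Module.End.isUnit_iff T).1 hT
  have bS := (Module.End.isUnit_iff S).1 hS
  refine ⟨fun f (hf : D f = 0) => ?_, bT.1.injOn, fun f (hf : D f = 0) => ?_⟩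
  · change D (T f) = 0
    rw [h', hf, map_zero]
  · obtain ⟨g, rfl⟩ := bT.2 f
    refine ⟨g, bS.1 ?_, rfl⟩
    rw [← h', hf, map_zero]

theorem pow_apply_eq_zero_of_le {D : Module.End R M} {f : M} {m k : ℕ} (hmk : m ≤ k)
    (hf : (D ^ m) f = 0) : (D ^ k) f = 0 := by
  rw [← Nat.sub_add_cancel hmk, pow_add, Module.End.mul_apply, hf, map_zero]

/-- If `P s` maps `ker D` into `ker (D ^ (s + 1))` for all `s`, then the sums of elements of
`P s (ker D)`, `s < k`, lie in `ker (D ^ k)`. -/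
theorem pow_sum_eq_zero {D : Module.End R M} {k : ℕ} {P : Fin k → Module.End R M}
    (hP : ∀ s : Fin k, Set.MapsTo (D ^ (s : ℕ) * P s) {f | D f = 0} {f | D f = 0})
    {g : Fin k → M} (hg : ∀ s, D (g s) = 0) : (D ^ k) (∑ s, P s (g s)) = 0 := by
  rw [map_sum]
  refine Finset.sum_eq_zero fun s _ => pow_apply_eq_zero_of_le (Nat.succ_le_of_lt s.2) ?_
  rw [pow_succ', Module.End.mul_apply]
  exact hP s (hg s)

/-- If every `D ^ s * P s` permutes `ker D`, then every element of `ker (D ^ k)` is a sum of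
elements of `P s (ker D)`, `s < k`. -/
theorem exists_sum_eq_of_pow_eq_zero {D : Module.End R M} {k : ℕ} {P : Fin k → Module.End R M}
    (hP : ∀ s : Fin k, Set.BijOn (D ^ (s : ℕ) * P s) {f | D f = 0} {f | D f = 0})
    {f : M} (hf : (D ^ k) f = 0) :
    ∃ g : Fin k → M, (∀ s, D (g s) = 0) ∧ f = ∑ s, P s (g s) := by
  induction k generalizing f with
  | zero => exact ⟨0, fun s => s.elim0, by simpa using hf⟩
  | succ k ih =>
    have hDf : D ((D ^ k) f) = 0 := by rwa [pow_succ', Module.End.mul_apply] at hf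
    obtain ⟨u, hu, huf⟩ := (hP (Fin.last k)).surjOn hDf
    simp only [Fin.val_last, Module.End.mul_apply] at huf
    obtain ⟨g, hg, hfg⟩ := ih (P := fun s => P s.castSucc) (fun s => hP s.castSucc)
      (f := f - P (Fin.last k) u) (by rw [map_sub, huf, sub_self])
    refine ⟨Fin.snoc (α := fun _ => M) g u,
      Fin.lastCases (by simpa using hu) (by simpa using hg), ?_⟩
    rw [Fin.sum_univ_castSucc]
    simp [← hfg]

/-- If every `D ^ s * P s` permutes `ker D`, then the coefficients in `ker D` of a sum
`∑ s, P s (g s)` are unique. -/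
theorem eq_zero_of_sum_eq_zero {D : Module.End R M} {k : ℕ} {P : Fin k → Module.End R M}
    (hP : ∀ s : Fin k, Set.BijOn (D ^ (s : ℕ) * P s) {f | D f = 0} {f | D f = 0})
    {g : Fin k → M} (hg : ∀ s, D (g s) = 0) (h : ∑ s, P s (g s) = 0) : g = 0 := by
  induction k with
  | zero => exact Subsingleton.elim _ _
  | succ k ih =>
    rw [Fin.sum_univ_castSucc] at h
    have hlow := pow_sum_eq_zero (P := fun s : Fin k => P s.castSucc)
      (fun s => (hP s.castSucc).mapsTo) (fun s => hg s.castSucc)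
    have hlast : g (Fin.last k) = 0 := by
      refine (hP (Fin.last k)).injOn (hg _) (map_zero D) ?_
      have := congrArg (D ^ k) h
      rw [map_add, hlow, zero_add, map_zero] at this
      simpa using this
    rw [hlast, map_zero, add_zero] at h
    have hinit := ih (P := fun s => P s.castSucc) (fun s => hP s.castSucc)
      (fun s => hg s.castSucc) h
    funext s
    exact Fin.lastCases hlast (fun i => congrFun hinit i) s

end Intertwining

section Umbral

variable {M : Type*} [AddCommGroup M] [Module ℝ M] {n : ℕ} {x D E A : Module.End ℝ M}

theorem Uop_succ_add_Uop (n : ℕ) (E : Module.End ℝ M) (s : ℕ) :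
    Uop n E (s + 1) + Uop n E s = E + ((n : ℝ) / 2 + s) • (1 : Module.End ℝ M) := by
  obtain ⟨m, rfl | rfl⟩ := Nat.even_or_odd' s
  · have h1 : (2 * m + 1) / 2 = m := by omega
    have h2 : (2 * m) / 2 = m := by omega
    have h3 : (2 * m + 1) % 2 = 1 := by omega
    simp only [Uop, h1, h2, h3, Nat.mul_mod_right, one_ne_zero, if_true, if_false]
    push_cast
    module
  · have h1 : (2 * m + 1) / 2 = m := by omega
    have h2 : (2 * m + 1 + 1) / 2 = m + 1 := by omega
    have h3 : (2 * m + 1) % 2 = 1 := by omega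
    have h4 : (2 * m + 1 + 1) % 2 = 0 := by omega
    simp only [Uop, h1, h2, h3, h4, one_ne_zero, if_true, if_false]
    push_cast
    module

theorem euler_mul_pow (hEx : E * x - x * E = x) (s : ℕ) :
    E * x ^ s = x ^ s * E + (s : ℝ) • x ^ s := by
  induction s with
  | zero => simp
  | succ s ih =>
    rw [pow_succ, ← mul_assoc, ih, add_mul, mul_assoc, sub_eq_iff_eq_add.1 hEx, mul_add,
      smul_mul_assoc, mul_assoc]
    push_cast
    module

/-- `D xˢ⁺¹ f = -2 xˢ U_{s+1} f` for `f ∈ ker D`. -/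
theorem dirac_pow_succ_apply
    (hxD : x * D + D * x = (-2 : ℝ) • E - (n : ℝ) • (1 : Module.End ℝ M))
    (hEx : E * x - x * E = x) {f : M} (hf : D f = 0) (s : ℕ) :
    D ((x ^ (s + 1)) f) = (-2 : ℝ) • (x ^ s) (Uop n E (s + 1) f) := by
  have hD (u : M) : D (x u) = (-2 : ℝ) • E u - (n : ℝ) • u - x (D u) :=
    eq_sub_of_add_eq' (LinearMap.congr_fun hxD u)
  have hE : E ((x ^ s) f) = (x ^ s) (E f) + (s : ℝ) • (x ^ s) f :=
    LinearMap.congr_fun (euler_mul_pow hEx s) f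
  have hU : Uop n E (s + 1) f = E f + ((n : ℝ) / 2 + s) • f - Uop n E s f :=
    eq_sub_of_add_eq (LinearMap.congr_fun (Uop_succ_add_Uop n E s) f)
  have hx : x (D ((x ^ s) f)) = (-2 : ℝ) • (x ^ s) (Uop n E s f) := by
    cases s with
    | zero => simp [hf, Uop]
    | succ s =>
      rw [dirac_pow_succ_apply hxD hEx hf s, map_smul, pow_succ' x s, Module.End.mul_apply]
  rw [pow_succ', Module.End.mul_apply, hD, hE, hx, hU, map_sub, map_add, map_smul]
  module

theorem bijOn_ker_Uop_succ (hED : E * D - D * E = -D)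
    (hE : ∀ j : ℕ, IsUnit (E + ((n : ℝ) / 2 + (j : ℝ)) • (1 : Module.End ℝ M))) (s : ℕ) :
    Set.BijOn (Uop n E (s + 1)) {f | D f = 0} {f | D f = 0} := by
  unfold Uop
  split_ifs with hs
  · have hpos : (((s + 1) / 2 : ℕ) : ℝ) ≠ 0 := by
      rw [Nat.cast_ne_zero]
      omega
    have hu : IsUnit ((((s + 1) / 2 : ℕ) : ℝ) • (1 : Module.End ℝ M)) := by
      rw [← Algebra.algebraMap_eq_smul_one]
      exact hpos.isUnit.map _
    exact bijOn_ker_of_intertwine (by simp) hu hu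
  · refine bijOn_ker_of_intertwine ?_ (hE _) (hE ((s + 1) / 2 + 1))
    simp only [mul_add, add_mul, smul_mul_assoc, mul_smul_comm, one_mul, mul_one]
    rw [sub_eq_iff_eq_add.1 hED]
    push_cast
    module

theorem bijOn_ker_pow_mul_pow
    (hxD : x * D + D * x = (-2 : ℝ) • E - (n : ℝ) • (1 : Module.End ℝ M))
    (hEx : E * x - x * E = x) (hED : E * D - D * E = -D)
    (hE : ∀ j : ℕ, IsUnit (E + ((n : ℝ) / 2 + (j : ℝ)) • (1 : Module.End ℝ M))) (s : ℕ) :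
    Set.BijOn (D ^ s * x ^ s) {f | D f = 0} {f | D f = 0} := by
  induction s with
  | zero => rw [pow_zero, pow_zero, one_mul]; exact Set.bijOn_id _
  | succ s ih =>
    have hu : IsUnit ((-2 : ℝ) • (1 : Module.End ℝ M)) := by
      rw [← Algebra.algebraMap_eq_smul_one]
      exact (show (-2 : ℝ) ≠ 0 by norm_num).isUnit.map _
    refine (((bijOn_ker_of_intertwine (D := D) (by simp) hu hu).comp ih).comp
      (bijOn_ker_Uop_succ hED hE s)).congr fun f hf => ?_
    simp only [Function.comp_apply, Module.End.mul_apply, LinearMap.smul_apply,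
      Module.End.one_apply]
    rw [pow_succ D, Module.End.mul_apply, dirac_pow_succ_apply hxD hEx hf, map_smul]

theorem mul_sub_smul_one_of_commutator {a : ℝ} (hA : A * D - D * A = a • D) (j : ℕ) :
    D * (A - (j * a) • (1 : Module.End ℝ M)) =
      (A - ((j + 1 : ℕ) * a) • (1 : Module.End ℝ M)) * D := by
  simp only [mul_sub, sub_mul, smul_mul_assoc, mul_smul_comm, one_mul, mul_one]
  rw [sub_eq_iff_eq_add.1 hA]
  push_cast
  module

theorem pow_mul_of_commutator {a : ℝ} (hA : A * D - D * A = a • D) (s : ℕ) :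
    D ^ s * A = (A - (s * a) • (1 : Module.End ℝ M)) * D ^ s := by
  induction s with
  | zero => simp
  | succ s ih =>
    rw [pow_succ', mul_assoc, ih, ← mul_assoc, mul_sub_smul_one_of_commutator hA, mul_assoc]

end Umbral

/-- Almansi decomposition with general polynomial-type operators
`P_s = A_s∘xˢ + R_s`, where `A_s∘D − D∘A_s = a_s·D`, each `A_s − j a_s·id` is
invertible, and `Dˢ∘R_s` vanishes on `ker D`. Then
`ker(Dᵏ) = P₀(ker D) ⊕ ⋯ ⊕ P_{k−1}(ker D)`. -/
theorem almansi_general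
    {M : Type*} [AddCommGroup M] [Module ℝ M] (n : ℕ) (hn : 0 < n)
    (x D E : Module.End ℝ M) (I : ℕ → Module.End ℝ M)
    (hxD : x * D + D * x = (-2 : ℝ) • E - (n : ℝ) • (1 : Module.End ℝ M))
    (hEx : E * x - x * E = x)
    (hED : E * D - D * E = -D)
    (hI : ∀ j : ℕ,
      (E + (((n : ℝ) / 2) + (j : ℝ)) • (1 : Module.End ℝ M)) * I j = 1 ∧
      I j * (E + (((n : ℝ) / 2) + (j : ℝ)) • (1 : Module.End ℝ M)) = 1)
    (k : ℕ) (hk : 1 ≤ k)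
    (A : Fin k → Module.End ℝ M) (a : Fin k → ℝ) (R : Fin k → Module.End ℝ M)
    (hA : ∀ s, A s * D - D * A s = a s • D)
    (hAinv : ∀ s, ∀ j : ℕ, IsUnit (A s - ((j : ℝ) * a s) • (1 : Module.End ℝ M)))
    (hR : ∀ s : Fin k, ∀ f : M, D f = 0 → (D ^ (s : ℕ)) ((R s) f) = 0) :
    (∀ f : M, (D ^ k) f = 0 ↔
      ∃ g : Fin k → M, (∀ s, D (g s) = 0) ∧
        f = ∑ s : Fin k, (A s * x ^ (s : ℕ) + R s) (g s)) ∧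
    (∀ g g' : Fin k → M, (∀ s, D (g s) = 0) → (∀ s, D (g' s) = 0) →
      ∑ s : Fin k, (A s * x ^ (s : ℕ) + R s) (g s) =
        ∑ s : Fin k, (A s * x ^ (s : ℕ) + R s) (g' s) →
      g = g') := by
  have hP (s : Fin k) : Set.BijOn (D ^ (s : ℕ) * (A s * x ^ (s : ℕ) + R s))
      {f | D f = 0} {f | D f = 0} := by
    refine ((bijOn_ker_of_intertwine (mul_sub_smul_one_of_commutator (hA s) s) (hAinv s s)
      (hAinv s (s + 1))).comp (bijOn_ker_pow_mul_pow hxD hEx hED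
        (fun j => ⟨⟨_, _, (hI j).1, (hI j).2⟩, rfl⟩) s)).congr fun f hf => ?_
    rw [mul_add, ← mul_assoc, pow_mul_of_commutator (hA s), LinearMap.add_apply,
      Module.End.mul_apply _ (R s), hR s f hf, add_zero, mul_assoc]
    rfl
  refine ⟨fun f => ⟨exists_sum_eq_of_pow_eq_zero hP, ?_⟩, fun g g' hg hg' h => ?_⟩
  · rintro ⟨g, hg, rfl⟩
    exact pow_sum_eq_zero (fun s => (hP s).mapsTo) hg
  · refine sub_eq_zero.1 (eq_zero_of_sum_eq_zero hP (fun s => ?_) ?_)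
    · rw [Pi.sub_apply, map_sub, hg, hg', sub_zero]
    · simp only [Pi.sub_apply, map_sub, Finset.sum_sub_distrib, h, sub_self]
end

section
/- For every k ∈ ℕ the operator Q_k maps ker D onto ker D: if D f = 0 then D(Q_k f) = 0, and every element of ker D is of the form Q_k f for some f ∈ ker D; that is, Q_k(ker D) = ker D. -/
/-- If `E D - D E = -D`, then `D (E + c) = (E + (c + 1)) D`. -/
theorem apply_add_smul_of_commutator_eq_neg {M : Type*} [AddCommGroup M] [Module ℝ M]
    {D E : Module.End ℝ M} (hED : E * D - D * E = -D) (c : ℝ) (f : M) :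
    D ((E + c • (1 : Module.End ℝ M)) f) = (E + (c + 1) • (1 : Module.End ℝ M)) (D f) := by
  have h := LinearMap.congr_fun hED f
  simp only [LinearMap.sub_apply, Module.End.mul_apply, LinearMap.neg_apply] at h
  have h' : D (E f) = E (D f) + D f := by
    rw [sub_eq_iff_eq_add] at h
    rw [h]
    abel
  simp only [LinearMap.add_apply, LinearMap.smul_apply, Module.End.one_apply, map_add, map_smul,
    h']
  module

/-- Each `(U_s)⁻¹` with `s ≠ 0` maps `ker D` onto `ker D`. -/
theorem UopInv_maps_ker_onto_ker {M : Type*} [AddCommGroup M] [Module ℝ M] (n : ℕ)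
    (D E : Module.End ℝ M) (I : ℕ → Module.End ℝ M)
    (hED : E * D - D * E = -D)
    (hI : ∀ j : ℕ,
      (E + (((n : ℝ) / 2) + (j : ℝ)) • (1 : Module.End ℝ M)) * I j = 1 ∧
      I j * (E + (((n : ℝ) / 2) + (j : ℝ)) • (1 : Module.End ℝ M)) = 1)
    {s : ℕ} (hs : s ≠ 0) :
    (∀ f : M, D f = 0 → D (UopInv I s f) = 0) ∧
    (∀ g : M, D g = 0 → ∃ f : M, D f = 0 ∧ UopInv I s f = g) := by
  unfold UopInv
  split_ifs with hpar
  · have hne : ((s / 2 : ℕ) : ℝ) ≠ 0 := by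
      rw [Nat.cast_ne_zero]
      omega
    refine ⟨fun f hf => by simp [hf], fun g hg => ⟨((s / 2 : ℕ) : ℝ) • g, by simp [hg], ?_⟩⟩
    rw [LinearMap.smul_apply, Module.End.one_apply, smul_smul, one_div_mul_cancel hne, one_smul]
  · generalize s / 2 = j
    refine ⟨fun f hf => ?_, fun g hg => ⟨_, ?_, LinearMap.congr_fun (hI j).2 g⟩⟩
    · have h := apply_add_smul_of_commutator_eq_neg hED ((n : ℝ) / 2 + j) (I j f)
      have h₁ := LinearMap.congr_fun (hI j).1 f
      rw [Module.End.mul_apply, Module.End.one_apply] at h₁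
      have h₂ := LinearMap.congr_fun (hI (j + 1)).2 (D (I j f))
      rw [Module.End.mul_apply, Module.End.one_apply, Nat.cast_succ, ← add_assoc, ← h, h₁, hf,
        map_zero] at h₂
      exact h₂.symm
    · rw [apply_add_smul_of_commutator_eq_neg hED, hg, map_zero]

/-- `Q_k` maps `ker D` onto `ker D`. -/
theorem Qop_maps_kerD_onto_kerD
    {M : Type*} [AddCommGroup M] [Module ℝ M] (n : ℕ) (hn : 0 < n)
    (x D E : Module.End ℝ M) (I : ℕ → Module.End ℝ M)
    (hxD : x * D + D * x = (-2 : ℝ) • E - (n : ℝ) • (1 : Module.End ℝ M))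
    (hEx : E * x - x * E = x)
    (hED : E * D - D * E = -D)
    (hI : ∀ j : ℕ,
      (E + (((n : ℝ) / 2) + (j : ℝ)) • (1 : Module.End ℝ M)) * I j = 1 ∧
      I j * (E + (((n : ℝ) / 2) + (j : ℝ)) • (1 : Module.End ℝ M)) = 1)
    (k : ℕ) :
    (∀ f : M, D f = 0 → D ((Qop I k) f) = 0) ∧
    (∀ g : M, D g = 0 → ∃ f : M, D f = 0 ∧ (Qop I k) f = g) := by
  induction k with
  | zero => exact ⟨fun f hf => hf, fun g hg => ⟨g, hg, rfl⟩⟩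
  | succ k ih =>
    obtain ⟨hmaps, hsurj⟩ := UopInv_maps_ker_onto_ker n D E I hED hI k.succ_ne_zero
    refine ⟨fun f hf => ?_, fun g hg => ?_⟩
    · rw [Qop, LinearMap.smul_apply, map_smul, Module.End.mul_apply, hmaps _ (ih.1 f hf),
        smul_zero]
    · obtain ⟨u, hu, rfl⟩ := hsurj g hg
      obtain ⟨f, hf, rfl⟩ := ih.2 u hu
      refine ⟨(-2 : ℝ) • f, by rw [map_smul, hf, smul_zero], ?_⟩
      rw [Qop, LinearMap.smul_apply, Module.End.mul_apply, map_smul, map_smul, smul_smul]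
      norm_num
end

section
/- For all natural numbers j and k with k > j, and every f ∈ M with D f = 0, one has Dᵏ( xʲ f ) = 0; in particular D^{k+1}( xᵏ (ker D) ) = {0} for every k ∈ ℕ. -/
/-- If `E` raises degree by one along `x`, then `E (xʲ f) = xʲ (E f + j f)`. -/
theorem euler_apply_pow {M : Type*} [AddCommGroup M] [Module ℝ M]
    {x E : Module.End ℝ M} (hEx : E * x - x * E = x) (j : ℕ) (f : M) :
    E ((x ^ j) f) = (x ^ j) (E f + (j : ℝ) • f) := by
  induction j with
  | zero => simp
  | succ j ih =>
    have h := LinearMap.congr_fun hEx ((x ^ j) f)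
    simp only [LinearMap.sub_apply, Module.End.mul_apply, ih] at h
    rw [sub_eq_iff_eq_add] at h
    simp only [pow_succ', Module.End.mul_apply, h, map_add, map_smul, Nat.cast_add,
      Nat.cast_one, add_smul, one_smul]
    abel

/-- On `xʲ⁺¹ (ker D)` the operator `D` takes values in `xʲ (ker D)`. -/
theorem exists_dirac_apply_pow_succ {M : Type*} [AddCommGroup M] [Module ℝ M]
    {c : ℝ} {x D E : Module.End ℝ M}
    (hxD : x * D + D * x = (-2 : ℝ) • E - c • (1 : Module.End ℝ M))
    (hEx : E * x - x * E = x) (hED : E * D - D * E = -D)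
    (j : ℕ) {f : M} (hf : D f = 0) :
    ∃ g : M, D g = 0 ∧ D ((x ^ (j + 1)) f) = (x ^ j) g := by
  have hDE : D (E f) = 0 := by
    have h := LinearMap.congr_fun hED f
    simpa [hf] using h
  have hDx (m : M) : D (x m) = (-2 : ℝ) • E m - c • m - x (D m) := by
    have h := LinearMap.congr_fun hxD m
    simp only [LinearMap.add_apply, LinearMap.sub_apply, LinearMap.smul_apply,
      Module.End.mul_apply, Module.End.one_apply] at h
    rw [← h]
    abel
  induction j with
  | zero => exact ⟨(-2 : ℝ) • E f - c • f, by simp [hf, hDE], by simp [hDx, hf]⟩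
  | succ j ih =>
    obtain ⟨g, hg, hgx⟩ := ih
    refine ⟨(-2 : ℝ) • (E f + ((j + 1 : ℕ) : ℝ) • f) - c • f - g, by simp [hf, hDE, hg], ?_⟩
    rw [pow_succ' x (j + 1), Module.End.mul_apply, hDx, hgx, euler_apply_pow hEx]
    simp only [map_sub, map_smul]
    rw [pow_succ' x j, Module.End.mul_apply x (x ^ j) g]

/-- `Dʲ⁺¹` annihilates `xʲ (ker D)`. -/
theorem dirac_pow_succ_apply_pow {M : Type*} [AddCommGroup M] [Module ℝ M]
    {c : ℝ} {x D E : Module.End ℝ M}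
    (hxD : x * D + D * x = (-2 : ℝ) • E - c • (1 : Module.End ℝ M))
    (hEx : E * x - x * E = x) (hED : E * D - D * E = -D)
    (j : ℕ) {f : M} (hf : D f = 0) : (D ^ (j + 1)) ((x ^ j) f) = 0 := by
  induction j generalizing f with
  | zero => simpa using hf
  | succ j ih =>
    obtain ⟨g, hg, hgx⟩ := exists_dirac_apply_pow_succ hxD hEx hED j hf
    rw [pow_succ, Module.End.mul_apply, hgx, ih hg]

/-- for `k > j` and `f ∈ ker D` one has `Dᵏ(xʲ f) = 0`; in particular
`D^{k+1}(xᵏ(ker D)) = {0}`. -/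
theorem iterated_dirac_annihilates
    {M : Type*} [AddCommGroup M] [Module ℝ M] (n : ℕ) (hn : 0 < n)
    (x D E : Module.End ℝ M)
    (hxD : x * D + D * x = (-2 : ℝ) • E - (n : ℝ) • (1 : Module.End ℝ M))
    (hEx : E * x - x * E = x)
    (hED : E * D - D * E = -D) :
    (∀ j k : ℕ, j < k → ∀ f : M, D f = 0 → (D ^ k) ((x ^ j) f) = 0) ∧
    (∀ k : ℕ, ∀ f : M, D f = 0 → (D ^ (k + 1)) ((x ^ k) f) = 0) := by
  refine ⟨fun j k hjk f hf => ?_, fun k f hf => dirac_pow_succ_apply_pow hxD hEx hED k hf⟩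
  obtain ⟨i, rfl⟩ := Nat.exists_eq_add_of_le' (Nat.succ_le_of_lt hjk)
  rw [pow_add, Module.End.mul_apply, dirac_pow_succ_apply_pow hxD hEx hED j hf, map_zero]
end

section
/- The elements x′, D′ and E′ + (n/2)·1 generate a finite-dimensional Lie (super)algebra of osp(1|2) type; concretely, with [a,b] = ab − ba, the following commutation relations hold: [x′, (x′)²] = 0; [Δ′, x′] = 2D′; [E′ + (n/2)·1, x′] = x′; [D′, (x′)²] = −2x′; [D′, Δ′] = 0; [E′ + (n/2)·1, D′] = −D′; [Δ′, (x′)²] = −4(E′ + (n/2)·1); [E′ + (n/2)·1, (x′)²] = 2(x′)²; and [E′ + (n/2)·1, Δ′] = −2Δ′. -/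
section Commutator

variable {A ι : Type*} [Ring A]

/-- The commutator with a fixed element is a derivation. -/
theorem commutator_mul (a b c : A) :
    a * (b * c) - b * c * a = (a * b - b * a) * c + b * (a * c - c * a) := by
  noncomm_ring

theorem commutator_sum (s : Finset ι) (a : A) (f : ι → A) :
    a * ∑ j ∈ s, f j - (∑ j ∈ s, f j) * a = ∑ j ∈ s, (a * f j - f j * a) := by
  rw [Finset.mul_sum, Finset.sum_mul, Finset.sum_sub_distrib]

theorem commutator_sum_mul_of_commute (s : Finset ι) (a : A) (e f : ι → A)
    (h : ∀ j, Commute a (e j)) :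
    a * ∑ j ∈ s, e j * f j - (∑ j ∈ s, e j * f j) * a
      = ∑ j ∈ s, e j * (a * f j - f j * a) := by
  rw [commutator_sum]
  refine Finset.sum_congr rfl fun j _ => ?_
  rw [commutator_mul, (h j).eq, sub_self, zero_mul, zero_add]

/-- A vector with commuting coordinates in a Clifford frame squares to minus the sum of the
squares of its coordinates, up to a factor `2`. -/
theorem two_mul_sq_clifford_sum [Fintype ι] [DecidableEq ι] (e x : ι → A)
    (he : ∀ j k, e j * e k + e k * e j = if j = k then (-2 : A) else 0)
    (hx : ∀ j k, Commute (x j) (x k)) (hex : ∀ j k, Commute (e j) (x k)) :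
    2 * ((∑ j, e j * x j) * ∑ j, e j * x j) = 2 * -∑ j, x j * x j := by
  have expand : (∑ j, e j * x j) * ∑ j, e j * x j = ∑ j, ∑ k, e j * e k * (x j * x k) := by
    rw [Finset.sum_mul_sum]
    refine Finset.sum_congr rfl fun j _ => Finset.sum_congr rfl fun k _ => ?_
    rw [mul_assoc, ← mul_assoc (x j), ← (hex k j).eq]
    simp only [mul_assoc]
  have swap : ∑ j, ∑ k, e j * e k * (x j * x k) = ∑ j, ∑ k, e k * e j * (x j * x k) := by
    rw [Finset.sum_comm]
    refine Finset.sum_congr rfl fun j _ => Finset.sum_congr rfl fun k _ => ?_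
    rw [(hx k j).eq]
  rw [expand, two_mul]
  nth_rewrite 2 [swap]
  simp only [← Finset.sum_add_distrib, ← add_mul, he, ite_mul, zero_mul, Finset.sum_ite_eq,
    Finset.mem_univ, if_true, mul_neg, neg_mul, Finset.sum_neg_distrib, Finset.mul_sum]

end Commutator


/-- with `X = x′`, `Dv = D′`, `Ev = E′`, `L = Δ′` and
`Eh = E′ + (n/2)·1`, the generators `x′`, `D′`, `E′ + (n/2)·1` satisfy the
`osp(1|2)`-type commutation relations. -/
theorem umbral_osp12_relations
    {A : Type*} [Ring A] [Algebra ℝ A] (n : ℕ) (hn : 1 ≤ n)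
    (x' O e : Fin n → A)
    (hO : ∀ j k, O j * O k - O k * O j = 0)
    (hx : ∀ j k, x' j * x' k - x' k * x' j = 0)
    (hOx : ∀ j k, O j * x' k - x' k * O j = if j = k then 1 else 0)
    (he : ∀ j k, e j * e k + e k * e j = if j = k then (-2 : A) else 0)
    (hex : ∀ j k, e j * x' k = x' k * e j)
    (heO : ∀ j k, e j * O k = O k * e j)
    :
    let X : A := ∑ j, e j * x' j
    let Dv : A := ∑ j, e j * O j
    let Ev : A := ∑ j, x' j * O j
    let L : A := ∑ j, O j * O j
    let Eh : A := Ev + ((n : ℝ) / 2) • (1 : A)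
    X * (X * X) - (X * X) * X = 0 ∧
    L * X - X * L = 2 * Dv ∧
    Eh * X - X * Eh = X ∧
    Dv * (X * X) - (X * X) * Dv = -2 * X ∧
    Dv * L - L * Dv = 0 ∧
    Eh * Dv - Dv * Eh = -Dv ∧
    L * (X * X) - (X * X) * L = -4 * Eh ∧
    Eh * (X * X) - (X * X) * Eh = 2 * (X * X) ∧
    Eh * L - L * Eh = -2 * L := by
  intro X Dv Ev L Eh
  have cO : ∀ j k, Commute (O j) (O k) := fun j k => sub_eq_zero.mp (hO j k)
  have cx : ∀ j k, Commute (x' j) (x' k) := fun j k => sub_eq_zero.mp (hx j k)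
  have cex : ∀ j k, Commute (e j) (x' k) := hex
  have ceO : ∀ j k, Commute (e j) (O k) := heO
  have hxO : ∀ j k, x' j * O k - O k * x' j = if k = j then -1 else 0 := fun j k => by
    rw [← neg_sub, hOx]; split_ifs <;> simp
  have ceL : ∀ j, Commute L (e j) := fun j =>
    Commute.sum_left _ _ _ fun k _ => ((ceO j k).mul_right (ceO j k)).symm
  have ceE : ∀ j, Commute Eh (e j) := fun j =>
    (Commute.sum_left _ _ _ fun k _ => ((cex j k).mul_right (ceO j k)).symm).add_left
      ((Commute.one_left _).smul_left _)
  have cOL : ∀ j, Commute (O j) L := fun j =>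
    Commute.sum_right _ _ _ fun k _ => (cO j k).mul_right (cO j k)
  have cDL : Commute Dv L := Commute.sum_left _ _ _ fun j _ => (ceL j).symm.mul_left (cOL j)
  have Lx : ∀ k, L * x' k - x' k * L = 2 * O k := fun k => by
    rw [← neg_sub, commutator_sum]
    simp only [commutator_mul, hxO]
    simp [Finset.sum_add_distrib, two_mul]
  have Eh_comm : ∀ a, Eh * a - a * Eh = Ev * a - a * Ev := fun a => by
    simp only [Eh, add_mul, mul_add, smul_mul_assoc, mul_smul_comm, one_mul, mul_one,
      add_sub_add_right_eq_sub]
  have Ex : ∀ k, Eh * x' k - x' k * Eh = x' k := fun k => by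
    rw [Eh_comm, ← neg_sub, commutator_sum]
    simp only [commutator_mul, hxO, hx]
    simp
  have EO : ∀ k, Eh * O k - O k * Eh = -O k := fun k => by
    rw [Eh_comm, ← neg_sub, commutator_sum]
    simp only [commutator_mul, hOx, hO]
    simp
  have Dx : ∀ k, Dv * x' k - x' k * Dv = e k := fun k => by
    rw [← neg_sub, commutator_sum_mul_of_commute _ _ _ _ fun j => (cex j k).symm]
    simp [hxO]
  have EX : Eh * X - X * Eh = X := by
    rw [commutator_sum_mul_of_commute _ _ _ _ ceE]
    simp only [Ex, X]
  have XX : X * X = -∑ j, x' j * x' j := by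
    have h := two_mul_sq_clifford_sum e x' he cx cex
    have h2 : IsUnit (2 : A) := by
      simpa only [map_ofNat] using (IsUnit.mk0 (2 : ℝ) two_ne_zero).map (algebraMap ℝ A)
    exact h2.mul_left_cancel h
  have Eh4 : 4 * Eh = ∑ j, 4 * (x' j * O j) + (2 * n : A) := by
    have hn2 : (4 : A) * (((n : ℝ) / 2) • (1 : A)) = 2 * n := by
      have : (4 : ℝ) * ((n : ℝ) / 2) = 2 * n := by ring
      simpa only [map_mul, map_ofNat, map_natCast, Algebra.algebraMap_eq_smul_one ((n : ℝ) / 2)]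
        using congrArg (algebraMap ℝ A) this
    rw [mul_add, hn2, Finset.mul_sum]
  refine ⟨by rw [mul_assoc, sub_self], ?_, EX, ?_, sub_eq_zero.mpr cDL, ?_, ?_, ?_, ?_⟩
  · rw [commutator_sum_mul_of_commute _ _ _ _ ceL]
    simp only [Lx, Dv, Finset.mul_sum]
    exact Finset.sum_congr rfl fun j _ => by noncomm_ring
  · rw [XX, mul_neg, neg_mul, sub_neg_eq_add, neg_add_eq_sub, ← neg_sub, commutator_sum,
      neg_mul, Finset.mul_sum]
    refine congrArg _ (Finset.sum_congr rfl fun j _ => ?_)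
    rw [commutator_mul, Dx, ← hex, two_mul]
  · rw [commutator_sum_mul_of_commute _ _ _ _ ceE]
    simp only [EO, Dv, mul_neg, Finset.sum_neg_distrib]
  · rw [XX, mul_neg, neg_mul, sub_neg_eq_add, neg_add_eq_sub, ← neg_sub, commutator_sum,
      neg_mul, Eh4]
    have hj : ∀ j, L * (x' j * x' j) - x' j * x' j * L = 4 * (x' j * O j) + 2 := fun j => by
      have h : O j * x' j = x' j * O j + 1 := by
        rw [← sub_eq_iff_eq_add', hOx, if_pos rfl]
      rw [commutator_mul, Lx, mul_assoc, h]
      noncomm_ring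
      simp
    simp only [hj, Finset.sum_add_distrib, Finset.sum_const, Finset.card_univ, Fintype.card_fin,
      nsmul_eq_mul, (Nat.cast_commute n (2 : A)).eq]
  · rw [commutator_mul, EX, two_mul]
  · rw [commutator_sum, Finset.mul_sum]
    refine Finset.sum_congr rfl fun j _ => ?_
    rw [commutator_mul, EO]
    noncomm_ring
end

section
/- The umbral spherical Dirac operator Γ′ = −x′D′ − E′ commutes with both the umbral Euler operator and the umbral Laplacian: [E′, Γ′] = 0 and [Δ′, Γ′] = 0, where [a,b] = ab − ba. -/
/-- If `a` commutes with every `e j`, and `a * y j - y j * a = z j`, then the commutator of `a`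
with `∑ j, e j * y j` is `∑ j, e j * z j`. -/
theorem sum_mul_commutator {A ι : Type*} [Ring A] [Fintype ι] {a : A} {e y z : ι → A}
    (he : ∀ j, e j * a = a * e j) (h : ∀ j, a * y j - y j * a = z j) :
    a * (∑ j, e j * y j) - (∑ j, e j * y j) * a = ∑ j, e j * z j := by
  rw [Finset.mul_sum, Finset.sum_mul, ← Finset.sum_sub_distrib]
  refine Finset.sum_congr rfl fun j _ => ?_
  rw [← h, ← mul_assoc, ← he]
  noncomm_ring

/-- Leibniz rule for the commutator with `c`, summed. -/
theorem sum_mul_commutator_right {A ι : Type*} [Ring A] [Fintype ι] (a b : ι → A) (c : A) :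
    (∑ j, a j * b j) * c - c * (∑ j, a j * b j) =
      ∑ j, (a j * (b j * c - c * b j) + (a j * c - c * a j) * b j) := by
  rw [Finset.mul_sum, Finset.sum_mul, ← Finset.sum_sub_distrib]
  refine Finset.sum_congr rfl fun j _ => ?_
  noncomm_ring

/-- An element commuting with all `a j` and `b j` commutes with `∑ j, a j * b j`. -/
theorem mul_sum_mul_comm {A ι : Type*} [Ring A] [Fintype ι] {a b : ι → A} {c : A}
    (ha : ∀ j, c * a j = a j * c) (hb : ∀ j, c * b j = b j * c) :
    c * (∑ j, a j * b j) = (∑ j, a j * b j) * c := by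
  rw [Finset.mul_sum, Finset.sum_mul]
  refine Finset.sum_congr rfl fun j _ => ?_
  rw [← mul_assoc, ha, mul_assoc, hb, mul_assoc]

/-- The Dirac operator squares to minus the Laplacian (stated doubled, so that `2` need not be
cancellable). -/
theorem two_mul_dirac_sq {A ι : Type*} [Ring A] [Fintype ι] [DecidableEq ι] {O e : ι → A}
    (hO : ∀ j k, O j * O k = O k * O j)
    (he : ∀ j k, e j * e k + e k * e j = if j = k then (-2 : A) else 0)
    (heO : ∀ j k, e j * O k = O k * e j) :
    2 * ((∑ j, e j * O j) * ∑ j, e j * O j) = -2 * ∑ j, O j * O j := by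
  have hDD : (∑ j, e j * O j) * (∑ j, e j * O j) = ∑ j, ∑ k, e j * e k * (O j * O k) := by
    rw [Finset.sum_mul_sum]
    refine Finset.sum_congr rfl fun j _ => Finset.sum_congr rfl fun k _ => ?_
    rw [mul_assoc, ← mul_assoc (O j), ← heO, mul_assoc, mul_assoc]
  have hDD' : (∑ j, e j * O j) * (∑ j, e j * O j) = ∑ j, ∑ k, e k * e j * (O j * O k) := by
    rw [hDD, Finset.sum_comm]
    refine Finset.sum_congr rfl fun j _ => Finset.sum_congr rfl fun k _ => ?_
    rw [hO]
  rw [two_mul]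
  nth_rw 1 [hDD]
  rw [hDD', ← Finset.sum_add_distrib, Finset.mul_sum]
  refine Finset.sum_congr rfl fun j _ => ?_
  simp only [← Finset.sum_add_distrib, ← add_mul, he, ite_mul, zero_mul, Finset.sum_ite_eq,
    Finset.mem_univ, if_true]


/-- the umbral spherical Dirac operator `Γ′ = −x′D′ − E′` commutes with
the umbral Euler operator `E′` and the umbral Laplacian `Δ′`. -/
theorem umbral_gamma_commutes
    {A : Type*} [Ring A] [Algebra ℝ A] (n : ℕ) (hn : 1 ≤ n)
    (x' O e : Fin n → A)
    (hO : ∀ j k, O j * O k - O k * O j = 0)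
    (hx : ∀ j k, x' j * x' k - x' k * x' j = 0)
    (hOx : ∀ j k, O j * x' k - x' k * O j = if j = k then 1 else 0)
    (he : ∀ j k, e j * e k + e k * e j = if j = k then (-2 : A) else 0)
    (hex : ∀ j k, e j * x' k = x' k * e j)
    (heO : ∀ j k, e j * O k = O k * e j)
    :
    let X : A := ∑ j, e j * x' j
    let Dv : A := ∑ j, e j * O j
    let Ev : A := ∑ j, x' j * O j
    let L : A := ∑ j, O j * O j
    let Γ : A := -(X * Dv) - Ev
    Ev * Γ - Γ * Ev = 0 ∧ L * Γ - Γ * L = 0 := by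
  intro X Dv Ev L Γ
  have hOc : ∀ j k, O j * O k = O k * O j := fun j k => sub_eq_zero.1 (hO j k)
  have hxO : ∀ j k, x' j * O k - O k * x' j = if j = k then -1 else 0 := fun j k => by
    rw [← neg_sub, hOx]
    split_ifs <;> simp_all
  have heE : ∀ j, e j * Ev = Ev * e j := fun j => mul_sum_mul_comm (hex j) (heO j)
  have heL : ∀ j, e j * L = L * e j := fun j => mul_sum_mul_comm (heO j) (heO j)
  have hLO : ∀ j, L * O j = O j * L := fun j => (mul_sum_mul_comm (hOc j) (hOc j)).symm
  have hEx : ∀ k, Ev * x' k - x' k * Ev = x' k := fun k => by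
    simp [Ev, sum_mul_commutator_right, hOx, hx]
  have hEO : ∀ k, Ev * O k - O k * Ev = -O k := fun k => by
    simp [Ev, sum_mul_commutator_right, hO, hxO]
  have hLx : ∀ k, L * x' k - x' k * L = 2 * O k := fun k => by
    simp [L, sum_mul_commutator_right, hOx, Finset.sum_add_distrib, two_mul]
  have hEX : Ev * X - X * Ev = X := sum_mul_commutator heE hEx
  have hED : Ev * Dv - Dv * Ev = -Dv := by
    simpa [Dv] using sum_mul_commutator heE hEO
  have hLX : L * X - X * L = 2 * Dv := by
    rw [sum_mul_commutator heL hLx, Finset.mul_sum]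
    exact Finset.sum_congr rfl fun j _ => by noncomm_ring
  have hLD : L * Dv - Dv * L = 0 := by
    simpa using sum_mul_commutator heL fun j => sub_eq_zero.2 (hLO j)
  have hLE : L * Ev - Ev * L = 2 * L := by
    rw [← neg_sub, sum_mul_commutator_right, ← Finset.sum_neg_distrib, Finset.mul_sum]
    refine Finset.sum_congr rfl fun j _ => ?_
    rw [← hLO, sub_self, mul_zero, zero_add, ← neg_mul, neg_sub, hLx, mul_assoc]
  have hDD : 2 * (Dv * Dv) = -2 * L := two_mul_dirac_sq hOc he heO
  constructor
  · calc Ev * Γ - Γ * Ev = -((Ev * X - X * Ev) * Dv + X * (Ev * Dv - Dv * Ev)) := by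
          simp only [Γ]
          noncomm_ring
      _ = 0 := by
          rw [hEX, hED]
          noncomm_ring
  · calc L * Γ - Γ * L
          = -((L * X - X * L) * Dv + X * (L * Dv - Dv * L)) - (L * Ev - Ev * L) := by
          simp only [Γ]
          noncomm_ring
      _ = 0 := by
          rw [hLX, hLD, hLE, mul_assoc, hDD]
          noncomm_ring
end

section
/- Let f : Ω → V be continuously differentiable and let s > 0. Then for every x ∈ Ω one has f(x) = (I_s(E_s f))(x), i.e. ∫₀¹ ( s f(tx) + (df)_{tx}(tx) ) t^{s−1} dt = f(x); moreover the function I_s f is continuously differentiable on Ω and (E_s(I_s f))(x) = f(x) for every x ∈ Ω. In other words, I_s is a two-sided inverse of the operator E_s = s·id + E on C¹(Ω, V). -/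
open MeasureTheory

open Set Filter Topology

section StarConvexDilation

variable {E W : Type*} [NormedAddCommGroup E] [NormedSpace ℝ E]
  [NormedAddCommGroup W] {Ω : Set E} {g : E → W} {a : ℝ}

theorem StarConvex.continuousOn_comp_smul (hΩ : StarConvex ℝ 0 Ω) (hg : ContinuousOn g Ω)
    {x : E} (hx : x ∈ Ω) : ContinuousOn (fun t : ℝ => g (t • x)) (Icc 0 1) :=
  hg.comp (by fun_prop) fun _ ht => hΩ.smul_mem hx ht.1 ht.2

/-- A function continuous on a star-shaped open set is bounded on all segments from the
center to points near a given point. -/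
theorem StarConvex.exists_eventually_norm_smul_le [LocallyCompactSpace E]
    (hΩ : StarConvex ℝ 0 Ω) (hΩo : IsOpen Ω) (hg : ContinuousOn g Ω) {x : E} (hx : x ∈ Ω) :
    ∃ C : ℝ, ∀ᶠ y in 𝓝 x, y ∈ Ω ∧ ∀ t ∈ Icc (0 : ℝ) 1, ‖g (t • y)‖ ≤ C := by
  obtain ⟨K, hK, hKΩ, hKc⟩ := local_compact_nhds (hΩo.mem_nhds hx)
  have hcomp : IsCompact ((fun p : ℝ × E => p.1 • p.2) '' (Icc 0 1 ×ˢ K)) :=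
    (isCompact_Icc.prod hKc).image (by fun_prop)
  obtain ⟨C, hC⟩ := hcomp.exists_bound_of_continuousOn (f := g) <| hg.mono <| by
    rintro _ ⟨⟨t, y⟩, ⟨ht, hy⟩, rfl⟩
    exact hΩ.smul_mem (hKΩ hy) ht.1 ht.2
  refine ⟨C, ?_⟩
  filter_upwards [hK] with y hy
  exact ⟨hKΩ hy, fun t ht => hC _ ⟨(t, y), ⟨ht, hy⟩, rfl⟩⟩

variable [NormedSpace ℝ W]

theorem StarConvex.intervalIntegrable_rpow_smul (hΩ : StarConvex ℝ 0 Ω)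
    (hg : ContinuousOn g Ω) (ha : -1 < a) {x : E} (hx : x ∈ Ω) :
    IntervalIntegrable (fun t : ℝ => t ^ a • g (t • x)) volume 0 1 := by
  refine (intervalIntegral.intervalIntegrable_rpow' ha).smul_continuousOn ?_
  rw [uIcc_of_le zero_le_one]
  exact hΩ.continuousOn_comp_smul hg hx

theorem StarConvex.continuousOn_integral_rpow_smul [LocallyCompactSpace E]
    (hΩ : StarConvex ℝ 0 Ω) (hΩo : IsOpen Ω) (hg : ContinuousOn g Ω) (ha : -1 < a) :
    ContinuousOn (fun y => ∫ t in (0 : ℝ)..1, t ^ a • g (t • y)) Ω := by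
  intro x hx
  obtain ⟨C, hC⟩ := hΩ.exists_eventually_norm_smul_le hΩo hg hx
  refine ContinuousAt.continuousWithinAt <|
    intervalIntegral.continuousAt_of_dominated_interval (bound := fun t => t ^ a * C) ?_ ?_
      ((intervalIntegral.intervalIntegrable_rpow' ha).mul_const C) ?_
  · filter_upwards [hC] with y hy
    exact (hΩ.intervalIntegrable_rpow_smul hg ha hy.1).aestronglyMeasurable_restrict_uIoc
  · filter_upwards [hC] with y hy
    refine ae_of_all _ fun t ht => ?_
    rw [uIoc_of_le zero_le_one] at ht
    have h0 : 0 ≤ t ^ a := Real.rpow_nonneg ht.1.le a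
    rw [norm_smul, Real.norm_of_nonneg h0]
    exact mul_le_mul_of_nonneg_left (hy.2 t (Ioc_subset_Icc_self ht)) h0
  · refine ae_of_all _ fun t ht => ?_
    rw [uIoc_of_le zero_le_one] at ht
    have hgt : ContinuousAt g (t • x) :=
      hg.continuousAt (hΩo.mem_nhds (hΩ.smul_mem hx ht.1.le ht.2))
    exact (ContinuousAt.comp (f := fun y : E => t • y) hgt (by fun_prop)).const_smul _

theorem StarConvex.hasFDerivAt_integral_rpow_smul [LocallyCompactSpace E]
    (hΩ : StarConvex ℝ 0 Ω) (hΩo : IsOpen Ω) (hg : ContDiffOn ℝ 1 g Ω) (ha : -1 < a)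
    {x : E} (hx : x ∈ Ω) :
    HasFDerivAt (fun y => ∫ t in (0 : ℝ)..1, t ^ a • g (t • y))
      (∫ t in (0 : ℝ)..1, t ^ (a + 1) • fderiv ℝ g (t • x)) x := by
  have hg' : ContinuousOn (fderiv ℝ g) Ω := hg.continuousOn_fderiv_of_isOpen hΩo le_rfl
  have ha' : -1 < a + 1 := by linarith
  obtain ⟨C, hC⟩ := hΩ.exists_eventually_norm_smul_le hΩo hg' hx
  refine intervalIntegral.hasFDerivAt_integral_of_dominated_of_fderiv_le
    (F' := fun y t => t ^ (a + 1) • fderiv ℝ g (t • y))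
    (bound := fun t => t ^ (a + 1) * C) hC ?_
    (hΩ.intervalIntegrable_rpow_smul hg.continuousOn ha hx)
    (hΩ.intervalIntegrable_rpow_smul hg' ha' hx).aestronglyMeasurable_restrict_uIoc ?_
    ((intervalIntegral.intervalIntegrable_rpow' ha').mul_const C) ?_
  · filter_upwards [hC] with y hy
    exact (hΩ.intervalIntegrable_rpow_smul hg.continuousOn ha
      hy.1).aestronglyMeasurable_restrict_uIoc
  · refine ae_of_all _ fun t ht y hy => ?_
    rw [uIoc_of_le zero_le_one] at ht
    have h0 : 0 ≤ t ^ (a + 1) := Real.rpow_nonneg ht.1.le _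
    rw [norm_smul, Real.norm_of_nonneg h0]
    exact mul_le_mul_of_nonneg_left (hy.2 t (Ioc_subset_Icc_self ht)) h0
  · refine ae_of_all _ fun t ht y hy => ?_
    rw [uIoc_of_le zero_le_one] at ht
    have hgt : HasFDerivAt g (fderiv ℝ g (t • y)) (t • y) :=
      ((hg.differentiableOn one_ne_zero).differentiableAt
        (hΩo.mem_nhds (hΩ.smul_mem hy.1 ht.1.le ht.2))).hasFDerivAt
    have hcomp := (hgt.comp y ((hasFDerivAt_id y).const_smul t)).const_smul (t ^ a)
    refine hcomp.congr_fderiv ?_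
    ext v
    simp [Real.rpow_add ht.1, mul_smul]

theorem StarConvex.contDiffOn_integral_rpow_smul [LocallyCompactSpace E]
    (hΩ : StarConvex ℝ 0 Ω) (hΩo : IsOpen Ω) (hg : ContDiffOn ℝ 1 g Ω) (ha : -1 < a) :
    ContDiffOn ℝ 1 (fun y => ∫ t in (0 : ℝ)..1, t ^ a • g (t • y)) Ω := by
  have hderiv := fun x hx => hΩ.hasFDerivAt_integral_rpow_smul hΩo hg ha (x := x) hx
  rw [← zero_add (1 : WithTop ℕ∞), contDiffOn_succ_iff_fderiv_of_isOpen hΩo]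
  refine ⟨fun x hx => (hderiv x hx).differentiableAt.differentiableWithinAt, by simp, ?_⟩
  exact contDiffOn_zero.2 <| (hΩ.continuousOn_integral_rpow_smul hΩo
    (hg.continuousOn_fderiv_of_isOpen hΩo le_rfl) (by linarith)).congr
      fun x hx => (hderiv x hx).fderiv

theorem StarConvex.integral_rpow_smul_euler [CompleteSpace W]
    (hΩ : StarConvex ℝ 0 Ω) (hΩo : IsOpen Ω) (hg : ContDiffOn ℝ 1 g Ω) {s : ℝ} (hs : 0 < s)
    {x : E} (hx : x ∈ Ω) :
    ∫ t in (0 : ℝ)..1, t ^ (s - 1) • (s • g (t • x) + fderiv ℝ g (t • x) (t • x)) = g x := by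
  have hg' : ContinuousOn (fderiv ℝ g) Ω := hg.continuousOn_fderiv_of_isOpen hΩo le_rfl
  have hcont : ContinuousOn (fun y => s • g y + fderiv ℝ g y y) Ω :=
    (hg.continuousOn.const_smul s).add (hg'.clm_apply continuousOn_id)
  have hpow : Continuous fun t : ℝ => t ^ s := Real.continuous_rpow_const hs.le
  have key := intervalIntegral.integral_eq_sub_of_hasDerivAt_of_le zero_le_one
    (f := fun t : ℝ => t ^ s • g (t • x))
    (hpow.continuousOn.smul (hΩ.continuousOn_comp_smul hg.continuousOn hx))
    (fun t ht => ?_) (hΩ.intervalIntegrable_rpow_smul hcont (a := s - 1) (by linarith) hx)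
  · simpa [Real.zero_rpow hs.ne'] using key
  · have hgt : HasFDerivAt g (fderiv ℝ g (t • x)) (t • x) :=
      ((hg.differentiableOn one_ne_zero).differentiableAt
        (hΩo.mem_nhds (hΩ.smul_mem hx ht.1.le ht.2.le))).hasFDerivAt
    have hline : HasDerivAt (fun t : ℝ => t • x) x t := by
      simpa using (hasDerivAt_id t).smul_const x
    have hprod := (Real.hasDerivAt_rpow_const (p := s) (Or.inl ht.1.ne')).smul
      (hgt.comp_hasDerivAt t hline)
    refine hprod.congr_deriv ?_
    have hts : t ^ s = t ^ (s - 1) * t := by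
      rw [Real.rpow_sub_one ht.1.ne', div_mul_cancel₀ _ ht.1.ne']
    simp only [Function.comp_apply, map_smul, hts]
    module

end StarConvexDilation

/-- on a starlike open set `Ω ⊆ ℝⁿ` with center `0`, for `s > 0` the
operator `(I_s f)(x) = ∫₀¹ f(tx) t^{s−1} dt` is a two-sided inverse of the Euler-type
operator `(E_s f)(x) = s f(x) + (df)ₓ(x)` on `C¹(Ω, V)`. -/
theorem Is_two_sided_inverse_of_Es
    (n : ℕ) (hn : 1 ≤ n)
    {V : Type*} [NormedAddCommGroup V] [NormedSpace ℝ V] [FiniteDimensional ℝ V]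
    (Ω : Set (EuclideanSpace ℝ (Fin n))) (hΩ : IsOpen Ω)
    (hstar : ∀ x ∈ Ω, ∀ t : ℝ, 0 ≤ t → t ≤ 1 → t • x ∈ Ω)
    (f : EuclideanSpace ℝ (Fin n) → V) (hf : ContDiffOn ℝ 1 f Ω)
    (s : ℝ) (hs : 0 < s) :
    (∀ x ∈ Ω,
      (∫ t in (0 : ℝ)..1,
          t ^ (s - 1) • (s • f (t • x) + (fderiv ℝ f (t • x)) (t • x))) = f x) ∧
    ContDiffOn ℝ 1 (fun y => ∫ t in (0 : ℝ)..1, t ^ (s - 1) • f (t • y)) Ω ∧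
    (∀ x ∈ Ω,
      s • (∫ t in (0 : ℝ)..1, t ^ (s - 1) • f (t • x)) +
        (fderiv ℝ (fun y => ∫ t in (0 : ℝ)..1, t ^ (s - 1) • f (t • y)) x) x = f x) := by
  have hΩs : StarConvex ℝ 0 Ω :=
    starConvex_zero_iff.2 fun x hx t h0 h1 => hstar x hx t h0 h1
  have hs1 : -1 < s - 1 := by linarith
  have hinv := fun x hx => hΩs.integral_rpow_smul_euler hΩ hf hs (x := x) hx
  refine ⟨hinv, hΩs.contDiffOn_integral_rpow_smul hΩ hf hs1, fun x hx => ?_⟩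
  have hf' : ContinuousOn (fderiv ℝ f) Ω := hf.continuousOn_fderiv_of_isOpen hΩ le_rfl
  have hint₀ : IntervalIntegrable (fun t : ℝ => s • t ^ (s - 1) • f (t • x)) volume 0 1 :=
    (hΩs.intervalIntegrable_rpow_smul hf.continuousOn hs1 hx).smul s
  have hint := hΩs.intervalIntegrable_rpow_smul hf' (a := s - 1 + 1) (by linarith) hx
  rw [(hΩs.hasFDerivAt_integral_rpow_smul hΩ hf hs1 hx).fderiv,
    ContinuousLinearMap.intervalIntegral_apply hint, ← intervalIntegral.integral_smul,
    ← intervalIntegral.integral_add hint₀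
      ⟨hint.1.apply_continuousLinearMap x, hint.2.apply_continuousLinearMap x⟩, ← hinv x hx]
  refine intervalIntegral.integral_congr_ae (ae_of_all _ fun t ht => ?_)
  rw [uIoc_of_le zero_le_one] at ht
  simp only [Real.rpow_add_one ht.1.ne', map_smul, smul_apply]
  module
end

section
/- A shift-invariant ℝ-linear operator Q on ℝ[x₁,…,xₙ] has a two-sided inverse (there exists an ℝ-linear operator R on ℝ[x₁,…,xₙ] with Q∘R = R∘Q = id) if and only if Q applied to the constant polynomial 1 is nonzero, i.e. Q(1) ≠ 0. -/
open MvPolynomial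

/-- The shift operator `T_y : p(x) ↦ p(x + y)` on `ℝ[x₁,…,xₙ]`, as a linear map. -/
noncomputable def shiftOp (n : ℕ) (y : Fin n → ℝ) :
    Module.End ℝ (MvPolynomial (Fin n) ℝ) :=
  (MvPolynomial.aeval fun j => (MvPolynomial.X j : MvPolynomial (Fin n) ℝ) +
      MvPolynomial.C (y j)).toLinearMap

lemma shiftOp_X_mul {n : ℕ} (y : Fin n → ℝ) (i : Fin n) (p : MvPolynomial (Fin n) ℝ) :
    shiftOp n y (X i * p) = (X i + C (y i)) * shiftOp n y p := by
  simp [shiftOp]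

lemma shiftOp_C {n : ℕ} (y : Fin n → ℝ) (a : ℝ) : shiftOp n y (C a) = C a := by
  simp [shiftOp, algebraMap_eq]

lemma eval_zero_shiftOp {n : ℕ} (y : Fin n → ℝ) (p : MvPolynomial (Fin n) ℝ) :
    eval 0 (shiftOp n y p) = eval y p := by
  induction p using MvPolynomial.induction_on with
  | C a => simp [shiftOp_C]
  | add p q hp hq => rw [map_add, map_add, map_add, hp, hq]
  | mul_X p i hp => rw [mul_comm, shiftOp_X_mul, map_mul, hp]; simp

/-- A polynomial fixed by every shift is constant. -/
lemma eq_C_of_forall_shiftOp_eq {n : ℕ} {p : MvPolynomial (Fin n) ℝ}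
    (h : ∀ y, shiftOp n y p = p) : p = C (eval 0 p) :=
  MvPolynomial.funext fun y => by rw [← eval_zero_shiftOp, h, eval_C]

/-- The polynomials annihilated by every product of `d` difference operators `T_y - 1`. -/
noncomputable def differenceFiltration (n : ℕ) : ℕ → Submodule ℝ (MvPolynomial (Fin n) ℝ)
  | 0 => ⊥
  | d + 1 => ⨅ y : Fin n → ℝ, (differenceFiltration n d).comap (shiftOp n y - 1)

lemma mem_differenceFiltration_zero {n : ℕ} {p : MvPolynomial (Fin n) ℝ} :
    p ∈ differenceFiltration n 0 ↔ p = 0 :=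
  Submodule.mem_bot ℝ

lemma mem_differenceFiltration_succ {n d : ℕ} {p : MvPolynomial (Fin n) ℝ} :
    p ∈ differenceFiltration n (d + 1) ↔
      ∀ y, shiftOp n y p - p ∈ differenceFiltration n d := by
  simp [differenceFiltration]

lemma differenceFiltration_mono (n : ℕ) : Monotone (differenceFiltration n) := by
  refine monotone_nat_of_le_succ fun d => ?_
  induction d with
  | zero => exact bot_le
  | succ d ih =>
    intro p hp
    rw [mem_differenceFiltration_succ] at hp ⊢
    exact fun y => ih (hp y)

lemma X_mul_mem_differenceFiltration {n d : ℕ} (i : Fin n) {p : MvPolynomial (Fin n) ℝ}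
    (hp : p ∈ differenceFiltration n d) : X i * p ∈ differenceFiltration n (d + 1) := by
  induction d generalizing p with
  | zero =>
    rw [mem_differenceFiltration_zero.1 hp, mul_zero]
    exact zero_mem _
  | succ d ih =>
    refine mem_differenceFiltration_succ.2 fun y => ?_
    have hΔ := mem_differenceFiltration_succ.1 hp y
    have h : shiftOp n y (X i * p) - X i * p =
        X i * (shiftOp n y p - p) + y i • (p + (shiftOp n y p - p)) := by
      rw [shiftOp_X_mul, smul_eq_C_mul]
      ring
    rw [h]
    exact add_mem (ih hΔ) (Submodule.smul_mem _ _
      (add_mem hp (differenceFiltration_mono n d.le_succ hΔ)))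

lemma exists_mem_differenceFiltration {n : ℕ} (p : MvPolynomial (Fin n) ℝ) :
    ∃ d, p ∈ differenceFiltration n d := by
  induction p using MvPolynomial.induction_on with
  | C a =>
    refine ⟨1, mem_differenceFiltration_succ.2 fun y => ?_⟩
    rw [shiftOp_C, sub_self]
    exact zero_mem _
  | add p q hp hq =>
    obtain ⟨a, ha⟩ := hp
    obtain ⟨b, hb⟩ := hq
    exact ⟨max a b, add_mem (differenceFiltration_mono n (le_max_left a b) ha)
      (differenceFiltration_mono n (le_max_right a b) hb)⟩
  | mul_X p i hp =>
    obtain ⟨d, hd⟩ := hp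
    exact ⟨d + 1, mul_comm p (X i) ▸ X_mul_mem_differenceFiltration i hd⟩

/-- A shift-invariant operator killing constants lowers the difference filtration. -/
lemma apply_mem_differenceFiltration {n d : ℕ} {N : Module.End ℝ (MvPolynomial (Fin n) ℝ)}
    (hN : ∀ y, N * shiftOp n y = shiftOp n y * N) (hN1 : N 1 = 0)
    {p : MvPolynomial (Fin n) ℝ} (hp : p ∈ differenceFiltration n (d + 1)) :
    N p ∈ differenceFiltration n d := by
  induction d generalizing p with
  | zero =>
    have hpC : p = C (eval 0 p) := eq_C_of_forall_shiftOp_eq fun y =>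
      sub_eq_zero.1 (mem_differenceFiltration_zero.1 (mem_differenceFiltration_succ.1 hp y))
    rw [mem_differenceFiltration_zero, hpC, ← mul_one (C _), ← smul_eq_C_mul, map_smul, hN1,
      smul_zero]
  | succ d ih =>
    refine mem_differenceFiltration_succ.2 fun y => ?_
    have h : shiftOp n y (N p) = N (shiftOp n y p) := (LinearMap.congr_fun (hN y) p).symm
    rw [h, ← map_sub]
    exact ih (mem_differenceFiltration_succ.1 hp y)

/-- A nonzero scalar plus an operator lowering the difference filtration is bijective. -/
lemma bijective_of_sub_smul_mem_differenceFiltration {n : ℕ}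
    {Q : Module.End ℝ (MvPolynomial (Fin n) ℝ)} {c : ℝ} (hc : c ≠ 0)
    (hQ : ∀ d, ∀ p ∈ differenceFiltration n (d + 1), Q p - c • p ∈ differenceFiltration n d) :
    Function.Bijective Q := by
  constructor
  · refine (injective_iff_map_eq_zero Q).2 fun p hp => ?_
    obtain ⟨d, hd⟩ := exists_mem_differenceFiltration p
    induction d with
    | zero => exact mem_differenceFiltration_zero.1 hd
    | succ d ih =>
      have h := hQ d p hd
      rw [hp, zero_sub, neg_mem_iff] at h
      exact ih ((Submodule.smul_mem_iff _ hc).1 h)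
  · intro p
    obtain ⟨d, hd⟩ := exists_mem_differenceFiltration p
    induction d generalizing p with
    | zero => exact ⟨0, by rw [mem_differenceFiltration_zero.1 hd, map_zero]⟩
    | succ d ih =>
      obtain ⟨q, hq⟩ := ih _ (hQ d p hd)
      refine ⟨c⁻¹ • (p - q), ?_⟩
      rw [map_smul, map_sub, hq, sub_sub_cancel, inv_smul_smul₀ hc]

/-- a shift-invariant operator `Q` on `ℝ[x₁,…,xₙ]` has a two-sided
inverse if and only if `Q(1) ≠ 0`. -/
theorem shift_invariant_invertible_iff
    (n : ℕ) (hn : 1 ≤ n)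
    (Q : Module.End ℝ (MvPolynomial (Fin n) ℝ))
    (hQ : ∀ y : Fin n → ℝ, Q * shiftOp n y = shiftOp n y * Q) :
    (∃ R : Module.End ℝ (MvPolynomial (Fin n) ℝ), Q * R = 1 ∧ R * Q = 1) ↔
      Q (1 : MvPolynomial (Fin n) ℝ) ≠ 0 := by
  constructor
  · rintro ⟨R, -, hRQ⟩ h
    have h1 : R (Q 1) = 1 := LinearMap.congr_fun hRQ 1
    rw [h, map_zero] at h1
    exact zero_ne_one h1
  · intro h
    obtain ⟨c, hQ1⟩ : ∃ c, Q 1 = C c := by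
      refine ⟨_, eq_C_of_forall_shiftOp_eq fun y => ?_⟩
      have h1 : Q (shiftOp n y 1) = shiftOp n y (Q 1) := LinearMap.congr_fun (hQ y) 1
      rw [← h1, ← C_1, shiftOp_C]
    have hc : c ≠ 0 := by
      rintro rfl
      exact h (by rw [hQ1, C_0])
    have hbij : Function.Bijective Q := by
      refine bijective_of_sub_smul_mem_differenceFiltration hc fun d p hp => ?_
      refine apply_mem_differenceFiltration (N := Q - c • 1) (fun y => ?_) ?_ hp
      · rw [sub_mul, mul_sub, hQ, smul_mul_assoc, mul_smul_comm, one_mul, mul_one]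
      · simp [hQ1, smul_eq_C_mul]
    obtain ⟨u, rfl⟩ := (Module.End.isUnit_iff Q).2 hbij
    exact ⟨↑u⁻¹, u.mul_inv, u.inv_mul⟩
end
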